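/- Let T be a finite tree that is an iso-unique zero forcing graph, let 𝒫 be a minimum path cover of T, and let P : x_1,…,x_ℓ be a path of 𝒫. Set p = (ℓ+1)/2 if ℓ is odd and p = ℓ/2 if ℓ is even. Then: (a) if ℓ is odd, the connected components of T − x_p that contain x_{p−1} and x_{p+1}, respectively, are isomorphic; (b) if ℓ is even, the connected components of the graph obtained from T by deleting the edge x_p x_{p+1} that contain x_p and x_{p+1}, respectively, are isomorphic. Moreover, there is an automorphism of T that maps x_1 to x_ℓ and x_ℓ to x_1. -/

import Mathlib

/-- The set of vertices that eventually become active in the zero forcing process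
started from the set `S`: an active vertex whose neighbors, except exactly one,
are all active, forces the remaining one to become active. -/
inductive ZFClosed {V : Type*} (G : SimpleGraph V) (S : Set V) : V → Prop
  | init (v : V) (hv : v ∈ S) : ZFClosed G S v
  | force (u v : V) (hu : ZFClosed G S u) (huv : G.Adj u v)
      (hrest : ∀ w : V, G.Adj u w → w ≠ v → ZFClosed G S w) : ZFClosed G S v

/-- `S` is a zero forcing set of `G` if the zero forcing process started at `S`
activates all vertices. -/
def IsZeroForcingSet {V : Type*} (G : SimpleGraph V) (S : Set V) : Prop :=
  ∀ v : V, ZFClosed G S v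

/-- A minimum zero forcing set: a zero forcing set of minimum cardinality. -/
def IsMinZeroForcingSet {V : Type*} (G : SimpleGraph V) (S : Set V) : Prop :=
  IsZeroForcingSet G S ∧ ∀ S' : Set V, IsZeroForcingSet G S' → S.ncard ≤ S'.ncard

/-- `G` is iso-unique zero forcing: any two minimum zero forcing sets are mapped to each
other by some graph automorphism. -/
def IsoUniqueZF {V : Type*} (G : SimpleGraph V) : Prop :=
  ∀ S₁ S₂ : Set V, IsMinZeroForcingSet G S₁ → IsMinZeroForcingSet G S₂ →
    ∃ φ : G ≃g G, ⇑φ '' S₁ = S₂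

/-- A nonempty list of distinct vertices forming an induced path of `G`:
consecutive vertices are adjacent and non-consecutive vertices are non-adjacent. -/
def IsInducedPath {V : Type*} (G : SimpleGraph V) (l : List V) : Prop :=
  l ≠ [] ∧ l.Nodup ∧
  (∀ i j : Fin l.length, (i : ℕ) + 1 = (j : ℕ) → G.Adj (l.get i) (l.get j)) ∧
  (∀ i j : Fin l.length, (i : ℕ) + 1 < (j : ℕ) → ¬ G.Adj (l.get i) (l.get j))

/-- A path cover of `G`: a set of pairwise vertex-disjoint induced paths covering all
vertices of `G`. -/
def IsPathCover {V : Type*} [DecidableEq V] (G : SimpleGraph V) (P : Finset (List V)) : Prop :=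
  (∀ l ∈ P, IsInducedPath G l) ∧
  (∀ v : V, ∃ l ∈ P, v ∈ l) ∧
  (∀ l ∈ P, ∀ l' ∈ P, l ≠ l' → ∀ v : V, v ∈ l → v ∉ l')

/-- A minimum path cover: a path cover with the fewest possible number of paths. -/
def IsMinPathCover {V : Type*} [DecidableEq V] (G : SimpleGraph V)
    (P : Finset (List V)) : Prop :=
  IsPathCover G P ∧ ∀ Q : Finset (List V), IsPathCover G Q → P.card ≤ Q.card

/-- `x` is an interior vertex of some path of the cover `P`, i.e. it belongs to a path
of `P` and is not an end-vertex of that path. -/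
def InteriorIn {V : Type*} (P : Finset (List V)) (x : V) : Prop :=
  ∃ l ∈ P, ∃ h : l ≠ [], x ∈ l ∧ x ≠ l.head h ∧ x ≠ l.getLast h

/-- The connected component of a graph `G` containing a vertex `u`, viewed as the
subgraph of `G` induced by the set of vertices reachable from `u`. -/
def componentGraphOf {W : Type*} (G : SimpleGraph W) (u : W) :
    SimpleGraph {w : W | G.Reachable u w} :=
  G.induce {w : W | G.Reachable u w}

namespace SimpleGraph

variable {V W : Type*} {T : SimpleGraph V}

lemma Iso.dist_eq {G : SimpleGraph V} {H : SimpleGraph W} (φ : G ≃g H) (u v : V) :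
    H.dist (φ u) (φ v) = G.dist u v := by
  by_cases hr : G.Reachable u v
  · apply le_antisymm
    · obtain ⟨p, hp⟩ := hr.exists_walk_length_eq_dist
      rw [← hp, ← Walk.length_map φ.toHom p]
      exact dist_le _
    · obtain ⟨p, hp⟩ := (φ.reachable_iff.2 hr).exists_walk_length_eq_dist
      have h := dist_le (p.map φ.symm.toHom)
      have e (x : V) : φ.symm.toHom (φ x) = x := φ.symm_apply_apply x
      rw [Walk.length_map, hp, e, e] at h
      exact h
  · rw [dist_eq_zero_of_not_reachable hr,
      dist_eq_zero_of_not_reachable (fun h => hr (φ.reachable_iff.1 h))]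

lemma Connected.exists_adj_dist_eq_add_one {G : SimpleGraph V} (hG : G.Connected) {v y : V}
    (h : y ≠ v) : ∃ z, G.Adj y z ∧ G.dist v y = G.dist v z + 1 := by
  obtain ⟨p, hp⟩ := hG.exists_walk_length_eq_dist y v
  cases p with
  | nil => exact absurd rfl h
  | @cons _ z _ hz q =>
    refine ⟨z, hz, ?_⟩
    have h1 := dist_le q
    have h2 := hG.dist_triangle (u := y) (v := z) (w := v)
    rw [dist_eq_one_iff_adj.2 hz] at h2
    simp only [Walk.length_cons] at hp
    rw [dist_comm (u := v), dist_comm (u := v)]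
    omega

namespace IsTree

/-- The neighbor of `y` that is closer to `v` is unique. -/
lemma eq_of_adj_of_dist_lt (hT : T.IsTree) {v y z z' : V} (hz : T.Adj y z) (hz' : T.Adj y z')
    (h : T.dist v z < T.dist v y) (h' : T.dist v z' < T.dist v y) : z = z' := by
  have key : ∀ {w}, T.Adj y w → T.dist v w < T.dist v y →
      ∃ p : T.Walk v y, p.IsPath ∧ p.penultimate = w := by
    intro w hw hlt
    obtain ⟨p, hp⟩ := hT.connected.exists_walk_length_eq_dist v w
    refine ⟨p.concat hw.symm, ?_, by simp⟩
    apply Walk.isPath_of_length_eq_dist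
    have := hT.dist_eq_dist_add_one_of_adj v hw
    rw [Walk.length_concat]
    omega
  obtain ⟨p, hp, rfl⟩ := key hz h
  obtain ⟨q, hq, rfl⟩ := key hz' h'
  have := (hT.isAcyclic.subsingleton_path v y).elim ⟨p, hp⟩ ⟨q, hq⟩
  rw [Subtype.mk.injEq] at this
  rw [this]

/-- Only the edge `ab` joins the vertices closer to `a` to the vertices closer to `b`. -/
lemma eq_of_adj_of_adj_of_dist_lt (hT : T.IsTree) {a b y z : V} (hab : T.Adj a b)
    (hyz : T.Adj y z) (hy : T.dist a y < T.dist b y) (hz : T.dist b z < T.dist a z) :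
    y = a ∧ z = b := by
  have h1 := hT.dist_eq_dist_add_one_of_adj y hab
  have h2 := hT.dist_eq_dist_add_one_of_adj z hab
  have h3 := hT.dist_eq_dist_add_one_of_adj a hyz
  have h4 := hT.dist_eq_dist_add_one_of_adj b hyz
  simp only [dist_comm (u := y), dist_comm (u := z)] at h1 h2
  have hya : y = a := by
    by_contra hne
    obtain ⟨y', hy', hd⟩ := hT.connected.exists_adj_dist_eq_add_one hne
    have h5 := hT.dist_eq_dist_add_one_of_adj y' hab
    simp only [dist_comm (u := y')] at h5
    have h6 := hT.dist_eq_dist_add_one_of_adj b hy'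
    have : z = y' := hT.eq_of_adj_of_dist_lt (v := b) hyz hy' (by omega) (by omega)
    subst this
    omega
  refine ⟨hya, ?_⟩
  subst hya
  have h5 : T.dist b z = 0 := by rw [dist_self] at *; omega
  exact (hT.connected.dist_eq_zero_iff.1 h5).symm

/-- A vertex on the geodesic from `c` to `y` is determined by its distance to `c`. -/
lemma eq_of_dist_add_dist (hT : T.IsTree) {c y a b : V}
    (ha : T.dist c a + T.dist a y = T.dist c y) (hb : T.dist c b + T.dist b y = T.dist c y)
    (hab : T.dist c a = T.dist c b) : a = b := by
  induction hn : T.dist a y generalizing a b with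
  | zero =>
    rw [hT.connected.dist_eq_zero_iff.1 hn]
    exact (hT.connected.dist_eq_zero_iff.1 (show T.dist b y = 0 by omega)).symm
  | succ n ih =>
    have key : ∀ {w}, T.dist c w + T.dist w y = T.dist c y → T.dist w y = n + 1 →
        ∃ w', T.Adj w' w ∧ T.dist c w' = T.dist c w + 1 ∧ T.dist w' y = n := by
      intro w h1 h2
      obtain ⟨w', hw', hd⟩ := hT.connected.exists_adj_dist_eq_add_one (v := y) (y := w)
        (by rintro rfl; simp at h2)
      have h3 := hT.connected.dist_triangle (u := c) (v := w') (w := y)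
      have h4 := hT.dist_eq_dist_add_one_of_adj c hw'
      simp only [dist_comm (u := y)] at hd
      exact ⟨w', hw'.symm, by omega, by omega⟩
    obtain ⟨a', ha', ha1, ha2⟩ := key ha hn
    obtain ⟨b', hb', hb1, hb2⟩ := key hb (by omega)
    have : a' = b' := ih (by omega) (by omega) (by omega) ha2
    subst this
    exact hT.eq_of_adj_of_dist_lt (v := c) ha' hb' (by omega) (by omega)

/-- Along a path, the distance to a given vertex decreases up to some index and then increases. -/
lemma exists_dist_eq_along_path (hT : T.IsTree) {x : ℕ → V} {k : ℕ}
    (hadj : ∀ i < k, T.Adj (x i) (x (i + 1))) (hne : ∀ i, i + 2 ≤ k → x i ≠ x (i + 2)) (c : V) :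
    ∃ q ≤ k, ∀ i ≤ k, T.dist c (x i) = T.dist c (x q) + (i - q) + (q - i) := by
  induction k with
  | zero => exact ⟨0, le_rfl, fun i hi => by obtain rfl := Nat.le_zero.1 hi; omega⟩
  | succ k ih =>
    obtain ⟨q, hq, h⟩ := ih (fun i hi => hadj i (by omega)) (fun i hi => hne i (by omega))
    have hstep := hT.dist_eq_dist_add_one_of_adj c (hadj k (by omega))
    have hk := h k le_rfl
    by_cases hdec : T.dist c (x k) = T.dist c (x (k + 1)) + 1
    · have hqk : q = k := by
        by_contra hqk
        obtain ⟨j, rfl⟩ : ∃ j, k = j + 1 := ⟨k - 1, by omega⟩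
        have hj := h j (by omega)
        have heq := hT.eq_of_adj_of_dist_lt (v := c) (hadj j (by omega)).symm
          (hadj (j + 1) (by omega)) (by omega) (by omega)
        exact hne j (by omega) heq
      subst hqk
      refine ⟨q + 1, le_rfl, fun i hi => ?_⟩
      rcases hi.lt_or_eq with hi | rfl
      · have := h i (by omega)
        omega
      · omega
    · refine ⟨q, by omega, fun i hi => ?_⟩
      rcases hi.lt_or_eq with hi | rfl
      · exact h i (by omega)
      · omega

/-- An automorphism of a finite tree fixes a vertex or flips an edge. -/
lemma exists_fixed_vertex_or_edge [Finite V] (hT : T.IsTree) (φ : T ≃g T) :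
    ∃ c, φ c = c ∨ (T.Adj c (φ c) ∧ φ (φ c) = c) := by
  classical
  by_contra! hno
  have hnext (v : V) : ∃ z, T.Adj v z ∧ T.dist (φ v) v = T.dist (φ v) z + 1 :=
    hT.connected.exists_adj_dist_eq_add_one (hno v).1.symm
  choose next hadj hd using hnext
  cases nonempty_fintype V
  have hcard := hT.card_edgeFinset
  have hni : ¬ Function.Injective (fun v => (⟨s(v, next v), hadj v⟩ : T.edgeSet)) := by
    intro hinj
    have := Fintype.card_le_of_injective _ hinj
    rw [← edgeFinset_card] at this
    omega
  obtain ⟨v, w, heq, hvw⟩ : ∃ v w, s(v, next v) = s(w, next w) ∧ v ≠ w := by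
    simpa [Function.Injective, Subtype.ext_iff] using hni
  obtain ⟨h1, h2⟩ : v = next w ∧ next v = w := by
    rcases Sym2.eq_iff.1 heq with h | h
    · exact absurd h.1 hvw
    · exact h
  have hv := hd v
  have hw := hd w
  rw [h2, dist_comm, dist_comm (v := w)] at hv
  rw [← h1, dist_comm, dist_comm (v := v)] at hw
  have ha : T.Adj w v := by simpa [h2] using (hadj v).symm
  obtain ⟨e1, e2⟩ := hT.eq_of_adj_of_adj_of_dist_lt ha (φ.map_adj_iff.2 ha.symm)
    (by omega) (by omega)
  exact (hno v).2 (e1 ▸ ha.symm) (by rw [e1, e2])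

end IsTree

end SimpleGraph

section PathCover

variable {V : Type*} {G : SimpleGraph V}

lemma IsInducedPath.exists_parametrization {l : List V} (h : IsInducedPath G l) :
    ∃ x : ℕ → V, (∀ i (hi : i < l.length), l.get ⟨i, hi⟩ = x i) ∧
      (∀ i, i + 1 < l.length → G.Adj (x i) (x (i + 1))) ∧
      (∀ i j, i + 1 < j → j < l.length → ¬ G.Adj (x i) (x j)) ∧
      (∀ i j, i < j → j < l.length → x i ≠ x j) := by
  obtain ⟨hne, hnd, hadj, hnadj⟩ := h
  obtain ⟨x, hx⟩ : ∃ x : ℕ → V, ∀ i (hi : i < l.length), l.get ⟨i, hi⟩ = x i :=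
    ⟨fun i => l.getD i (l.head hne), fun i hi => by simp [hi]⟩
  refine ⟨x, hx, fun i hi => ?_, fun i j hij hj => ?_, fun i j hij hj => ?_⟩
  · rw [← hx i (by omega), ← hx (i + 1) hi]
    exact hadj ⟨i, by omega⟩ ⟨i + 1, hi⟩ rfl
  · rw [← hx i (by omega), ← hx j hj]
    exact hnadj ⟨i, by omega⟩ ⟨j, hj⟩ hij
  · rw [← hx i (by omega), ← hx j hj]
    intro e
    simpa [hij.ne] using hnd.injective_get e

lemma isInducedPath_singleton (v : V) : IsInducedPath G [v] := by
  refine ⟨by simp, by simp, fun i j h => ?_, fun i j h => ?_⟩ <;>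
  · have hi := i.2
    have hj := j.2
    simp only [List.length_singleton] at hi hj
    omega

lemma IsInducedPath.cons {u v : V} {t : List V} (h : IsInducedPath G (u :: t))
    (hv : v ∉ u :: t) (hadj : G.Adj v u) (hnadj : ∀ w ∈ t, ¬ G.Adj v w) :
    IsInducedPath G (v :: u :: t) := by
  obtain ⟨-, hnd, h1, h2⟩ := h
  refine ⟨by simp, List.nodup_cons.2 ⟨hv, hnd⟩, ?_, ?_⟩
  · rintro ⟨i, hi⟩ ⟨j, hj⟩ hij
    obtain rfl : i + 1 = j := hij
    cases i with
    | zero => exact hadj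
    | succ i => exact h1 ⟨i, by simpa using hi⟩ ⟨i + 1, by simpa using hj⟩ rfl
  · rintro ⟨i, hi⟩ ⟨j, hj⟩ hij
    change i + 1 < j at hij
    obtain ⟨j, rfl⟩ : ∃ j', j = j' + 2 := ⟨j - 2, by omega⟩
    cases i with
    | zero => exact hnadj _ (by simp)
    | succ i =>
      have hij' : i + 1 < j + 1 := by omega
      exact h2 ⟨i, by simpa using hi⟩ ⟨j + 1, by simpa using hj⟩ hij'

lemma IsInducedPath.reverse {l : List V} (h : IsInducedPath G l) :
    IsInducedPath G l.reverse := by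
  obtain ⟨hne, hnd, h1, h2⟩ := h
  refine ⟨by simpa, List.nodup_reverse.2 hnd, ?_, ?_⟩
  · rintro ⟨i, hi⟩ ⟨j, hj⟩ hij
    rw [List.length_reverse] at hi hj
    simp only [List.get_eq_getElem, List.getElem_reverse] at hij ⊢
    exact (h1 ⟨l.length - 1 - j, by omega⟩ ⟨l.length - 1 - i, by omega⟩
      (by change l.length - 1 - j + 1 = l.length - 1 - i; omega)).symm
  · rintro ⟨i, hi⟩ ⟨j, hj⟩ hij hadj
    rw [List.length_reverse] at hi hj
    simp only [List.get_eq_getElem, List.getElem_reverse] at hij hadj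
    exact h2 ⟨l.length - 1 - j, by omega⟩ ⟨l.length - 1 - i, by omega⟩
      (by change l.length - 1 - j + 1 < l.length - 1 - i; omega) hadj.symm

/-- The set of initial vertices of the lists in `P`. -/
def headSet (P : Finset (List V)) : Set V := {v | ∃ l ∈ P, l.head? = some v}

lemma headSet_ncard_le (P : Finset (List V)) : (headSet P).ncard ≤ P.card := by
  classical
  have hsub : some '' headSet P ⊆ ((P.image List.head? : Finset (Option V)) : Set (Option V)) := by
    rintro _ ⟨v, ⟨l, hl, hv⟩, rfl⟩
    exact Finset.mem_coe.2 (Finset.mem_image.2 ⟨l, hl, hv⟩)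
  rw [← Set.ncard_image_of_injective _ (Option.some_injective V)]
  refine (Set.ncard_le_ncard hsub (Finset.finite_toSet _)).trans ?_
  rw [Set.ncard_coe_finset]
  exact Finset.card_image_le

/-- If an automorphism maps `insert a H` onto `insert b H`, then `a` and `b` lie in the same
orbit of the automorphism group. -/
lemma exists_iso_apply_eq_of_image_insert [Finite V] {H : Set V} {a b : V} (ha : a ∉ H)
    (φ : G ≃g G) (hφ : φ '' insert a H = insert b H) : ∃ ψ : G ≃g G, ψ a = b := by
  by_contra hb
  let O : Set V := {v | ∃ ψ : G ≃g G, ψ a = v}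
  have hO (v : V) : φ v ∈ O ↔ v ∈ O :=
    ⟨fun ⟨ψ, h⟩ => ⟨ψ.trans φ.symm, by simp [h]⟩, fun ⟨ψ, h⟩ => ⟨ψ.trans φ, by simp [h]⟩⟩
  have h1 : φ '' (insert a (H ∩ O)) = H ∩ O := by
    have e1 : insert a (H ∩ O) = insert a H ∩ O := by
      rw [Set.insert_inter_of_mem (show a ∈ O from ⟨SimpleGraph.Iso.refl, rfl⟩)]
    have e2 : H ∩ O = insert b H ∩ O := by rw [Set.insert_inter_of_notMem (show b ∉ O from hb)]
    rw [e1, e2, ← hφ]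
    ext w
    constructor
    · rintro ⟨v, ⟨h, ho⟩, rfl⟩
      exact ⟨⟨v, h, rfl⟩, (hO v).2 ho⟩
    · rintro ⟨⟨v, h, rfl⟩, ho⟩
      exact ⟨v, ⟨h, (hO v).1 ho⟩, rfl⟩
  have h2 := Set.ncard_image_of_injective (insert a (H ∩ O)) φ.injective
  rw [h1, Set.ncard_insert_of_notMem (fun h => ha h.1)] at h2
  omega

variable [DecidableEq V]

/-- In a tree, the initial vertices of the paths of a path cover form a zero forcing set. -/
lemma IsPathCover.isZeroForcingSet_headSet [Finite V] {T : SimpleGraph V} (hT : T.IsTree)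
    {P : Finset (List V)} (hP : IsPathCover T P) : IsZeroForcingSet T (headSet P) := by
  obtain ⟨hpath, hcov, hdisj⟩ := hP
  -- a vertex where the process is stuck along its path because of a further inactive neighbor `w`
  let Stuck (u w : V) : Prop := ∃ l ∈ P, ∃ i, ∃ hi : i + 1 < l.length,
    u = l.get ⟨i, by omega⟩ ∧ (∀ t (ht : t ≤ i), ZFClosed T (headSet P) (l.get ⟨t, by omega⟩)) ∧
    T.Adj u w ∧ w ≠ l.get ⟨i + 1, hi⟩ ∧ ¬ ZFClosed T (headSet P) w
  have hstuck : ∀ l ∈ P, ∀ j (hj : j < l.length), ¬ ZFClosed T (headSet P) (l.get ⟨j, hj⟩) →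
      ∃ i, ∃ hi : i < j, ∃ w, Stuck (l.get ⟨i, by omega⟩) w ∧ w ≠ l.get ⟨i + 1, by omega⟩ := by
    classical
    intro l hl j hj hz
    have hex : ∃ i, ∃ hi : i < l.length, ¬ ZFClosed T (headSet P) (l.get ⟨i, hi⟩) := ⟨j, hj, hz⟩
    obtain ⟨hm, hmz⟩ := Nat.find_spec hex
    have hmin := fun t => Nat.find_min (m := t) hex
    have hle : Nat.find hex ≤ j := Nat.find_min' hex ⟨hj, hz⟩
    generalize Nat.find hex = m at hm hmz hmin hle
    have hm0 : m ≠ 0 := by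
      rintro rfl
      refine hmz (.init _ ⟨l, hl, ?_⟩)
      rw [List.head?_eq_getElem?, List.get_eq_getElem, List.getElem?_eq_getElem]
    obtain ⟨i, rfl⟩ := Nat.exists_eq_succ_of_ne_zero hm0
    have hact : ∀ t (ht : t ≤ i), ZFClosed T (headSet P) (l.get ⟨t, by omega⟩) := by
      intro t ht
      by_contra hc
      exact hmin t (by omega) ⟨_, hc⟩
    have hadj := (hpath l hl).2.2.1 ⟨i, by omega⟩ ⟨i + 1, hm⟩ rfl
    obtain ⟨w, hw1, hw2, hw3⟩ : ∃ w, T.Adj (l.get ⟨i, by omega⟩) w ∧ w ≠ l.get ⟨i + 1, hm⟩ ∧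
        ¬ ZFClosed T (headSet P) w := by
      by_contra! hc
      exact hmz (.force _ _ (hact i le_rfl) hadj hc)
    exact ⟨i, by omega, w, ⟨l, hl, i, hm, rfl, hact, hw1, hw2, hw3⟩, hw2⟩
  by_contra hcon
  obtain ⟨v, hv⟩ : ∃ v, ¬ ZFClosed T (headSet P) v := by simpa [IsZeroForcingSet] using hcon
  obtain ⟨l₀, hl₀, hvl₀⟩ := hcov v
  obtain ⟨⟨j₀, hj₀⟩, rfl⟩ := List.get_of_mem hvl₀
  obtain ⟨i₀, hi₀, w₀, hs₀, -⟩ := hstuck l₀ hl₀ j₀ hj₀ hv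
  set r := l₀.get ⟨i₀, by omega⟩ with hr
  have hr0 : T.dist r w₀ = T.dist r r + 1 := by
    obtain ⟨_, -, _, _, -, -, hadj, -⟩ := hs₀
    rw [SimpleGraph.dist_self, SimpleGraph.dist_eq_one_iff_adj.2 hadj]
  have hunbounded : ∀ n, ∃ u w, Stuck u w ∧ T.dist r w = T.dist r u + 1 ∧ n ≤ T.dist r u := by
    intro n
    induction n with
    | zero => exact ⟨r, w₀, hs₀, hr0, Nat.zero_le _⟩
    | succ n ih =>
      obtain ⟨u, w, ⟨l, hl, i, hi, rfl, hact, hadj, hne, hw⟩, hd, hn⟩ := ih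
      obtain ⟨l', hl', hwl'⟩ := hcov w
      obtain ⟨⟨j, hj⟩, rfl⟩ := List.get_of_mem hwl'
      have hu : l.get ⟨i, by omega⟩ ∉ l' := by
        intro hmem
        have : l = l' := by
          by_contra hll
          exact hdisj l hl l' hl' hll _ (List.get_mem _ _) hmem
        subst this
        rcases lt_trichotomy j (i + 1) with h | h | h
        · exact hw (hact j (by omega))
        · subst h; exact hne rfl
        · exact (hpath l hl).2.2.2 ⟨i, by omega⟩ ⟨j, hj⟩ h hadj
      obtain ⟨i', hi', w', hs, hw'⟩ := hstuck l' hl' j hj hw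
      have hadj' : T.Adj (l'.get ⟨i', by omega⟩) w' := by
        obtain ⟨_, -, _, _, -, -, h, -⟩ := hs
        exact h
      refine ⟨_, w', hs, ?_⟩
      have hxl (i) (hi : i < l'.length) : l'.get ⟨i, hi⟩ ∈ l' := List.get_mem _ _
      obtain ⟨x, hx, hxadj, -, hxne⟩ := (hpath l' hl').exists_parametrization
      simp only [hx] at hadj hd hw' hadj' hxl ⊢
      obtain ⟨q, hq, hV⟩ := hT.exists_dist_eq_along_path (x := x) (k := l'.length - 1)
        (fun i hi => hxadj i (by omega)) (fun i hi => hxne i (i + 2) (by omega) (by omega)) r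
      have hjV := hV j (by omega)
      have hqj : q = j := by
        rcases lt_trichotomy q j with h | h | h
        · exfalso
          obtain ⟨j, rfl⟩ : ∃ j', j = j' + 1 := ⟨j - 1, by omega⟩
          have := hV j (by omega)
          have e := hT.eq_of_adj_of_dist_lt (v := r) hadj.symm (hxadj j (by omega)).symm
            (by omega) (by omega)
          exact hu (e ▸ hxl j (by omega))
        · exact h
        · exfalso
          have := hV (j + 1) (by omega)
          have e := hT.eq_of_adj_of_dist_lt (v := r) hadj.symm (hxadj j (by omega))
            (by omega) (by omega)
          exact hu (e ▸ hxl (j + 1) (by omega))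
      subst hqj
      have hV1 := hV i' (by omega)
      have hV2 := hV (i' + 1) (by omega)
      refine ⟨?_, by omega⟩
      by_contra hc
      have hc' := hT.dist_eq_dist_add_one_of_adj r hadj'
      exact hw' (hT.eq_of_adj_of_dist_lt (v := r) hadj' (hxadj i' (by omega))
        (by omega) (by omega))
  obtain ⟨M, hM⟩ := (Set.finite_range (T.dist r)).bddAbove
  obtain ⟨u, -, -, -, hu⟩ := hunbounded (M + 1)
  have := hM ⟨u, rfl⟩
  omega

/-- The forcing process can be recorded by growing the paths of a partial path cover. -/
lemma IsZeroForcingSet.exists_isPathCover_of_partial [Fintype V] {S : Set V}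
    (hS : IsZeroForcingSet G S) (A : Finset V) (Q : Finset (List V)) (hSA : S ⊆ A)
    (hpath : ∀ l ∈ Q, IsInducedPath G l) (hmem : ∀ v, v ∈ A ↔ ∃ l ∈ Q, v ∈ l)
    (hdisj : ∀ l ∈ Q, ∀ l' ∈ Q, l ≠ l' → ∀ v : V, v ∈ l → v ∉ l')
    (htail : ∀ l ∈ Q, ∀ v ∈ l.tail, ∀ w, G.Adj v w → w ∈ A) :
    ∃ Q' : Finset (List V), IsPathCover G Q' ∧ Q'.card ≤ Q.card := by
  induction hn : Aᶜ.card generalizing A Q with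
  | zero =>
    rw [Finset.card_eq_zero, Finset.compl_eq_empty_iff] at hn
    exact ⟨Q, ⟨hpath, fun v => (hmem v).1 (by simp [hn]), hdisj⟩, le_rfl⟩
  | succ n ih =>
    obtain ⟨u, v, hu, hv, huv, hrest⟩ : ∃ u v, u ∈ A ∧ v ∉ A ∧ G.Adj u v ∧
        ∀ w, G.Adj u w → w ≠ v → w ∈ A := by
      by_contra! hc
      have hall : ∀ v, v ∈ A := fun v => by
        induction hS v with
        | init v hv => exact hSA hv
        | force u v _ huv _ hu hrest =>
          by_contra hv
          obtain ⟨w, h1, h2, h3⟩ := hc u v hu hv huv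
          exact h3 (hrest w h1 h2)
      rw [Finset.eq_univ_iff_forall.2 hall] at hn
      simp at hn
    obtain ⟨l, hl, hul⟩ := (hmem u).1 hu
    have hlA : ∀ l ∈ Q, v ∉ l := fun l hl h => hv ((hmem v).2 ⟨l, hl, h⟩)
    obtain ⟨t, rfl⟩ : ∃ t, l = u :: t := by
      cases l with
      | nil => simp at hul
      | cons a t =>
        rcases List.mem_cons.1 hul with rfl | h
        · exact ⟨t, rfl⟩
        · exact absurd (htail _ hl u h v huv) hv
    have hcard : (insert (v :: u :: t) (Q.erase (u :: t))).card ≤ Q.card :=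
      (Finset.card_insert_le _ _).trans (Finset.card_erase_add_one hl).le
    refine (ih (insert v A) (insert (v :: u :: t) (Q.erase (u :: t)))
      (hSA.trans (by simp)) ?_ ?_ ?_ ?_ ?_).imp fun Q' h => ⟨h.1, h.2.trans hcard⟩
    · intro l' hl'
      rcases Finset.mem_insert.1 hl' with rfl | hl'
      · exact (hpath _ hl).cons (hlA _ hl) huv.symm
          fun w hw h => hv (htail _ hl w hw v h.symm)
      · exact hpath _ (Finset.mem_of_mem_erase hl')
    · intro w
      simp only [Finset.mem_insert, hmem, Finset.mem_erase]
      constructor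
      · rintro (rfl | ⟨l', hl', hw⟩)
        · exact ⟨_, Or.inl rfl, by simp⟩
        · by_cases h : l' = u :: t
          · exact ⟨_, Or.inl rfl, List.mem_cons_of_mem _ (h ▸ hw)⟩
          · exact ⟨l', Or.inr ⟨h, hl'⟩, hw⟩
      · rintro ⟨l', rfl | ⟨-, hl'⟩, hw⟩
        · rcases List.mem_cons.1 hw with h | h
          · exact Or.inl h
          · exact Or.inr ⟨_, hl, h⟩
        · exact Or.inr ⟨l', hl', hw⟩
    · have key : ∀ l' ∈ Q.erase (u :: t), ∀ w ∈ v :: u :: t, w ∉ l' := by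
        intro l' hl' w hw hw'
        obtain ⟨hne, hl'⟩ := Finset.mem_erase.1 hl'
        rcases List.mem_cons.1 hw with rfl | h
        · exact hlA _ hl' hw'
        · exact hdisj _ hl _ hl' hne.symm w h hw'
      intro l₁ h₁ l₂ h₂ hne w hw₁ hw₂
      rcases Finset.mem_insert.1 h₁ with rfl | h₁ <;> rcases Finset.mem_insert.1 h₂ with rfl | h₂
      · exact hne rfl
      · exact key _ h₂ w hw₁ hw₂
      · exact key _ h₁ w hw₂ hw₁
      · exact hdisj _ (Finset.mem_of_mem_erase h₁) _ (Finset.mem_of_mem_erase h₂) hne w hw₁ hw₂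
    · intro l' hl' w hw y hwy
      rcases Finset.mem_insert.1 hl' with rfl | hl'
      · rcases List.mem_cons.1 hw with rfl | h
        · by_cases hy : y = v
          · simp [hy]
          · exact Finset.mem_insert_of_mem (hrest y hwy hy)
        · exact Finset.mem_insert_of_mem (htail _ hl w h y hwy)
      · exact Finset.mem_insert_of_mem (htail _ (Finset.mem_of_mem_erase hl') w hw y hwy)
    · rw [Finset.compl_insert, Finset.card_erase_of_mem (by simpa using hv), hn,
        Nat.add_sub_cancel]

lemma IsZeroForcingSet.exists_isPathCover [Fintype V] {S : Set V} (hS : IsZeroForcingSet G S) :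
    ∃ Q : Finset (List V), IsPathCover G Q ∧ Q.card ≤ S.ncard := by
  classical
  obtain ⟨Q, hQ, hcard⟩ := hS.exists_isPathCover_of_partial S.toFinset
    (S.toFinset.image fun v => [v]) (by simp)
    (by simpa using fun v _ => isInducedPath_singleton v)
    (by simp)
    (by
      simp only [Finset.mem_image, forall_exists_index, and_imp]
      rintro _ a - rfl _ b - rfl hne v hv hv'
      rw [List.mem_singleton] at hv hv'
      exact hne (by rw [← hv, ← hv']))
    (by simp)
  refine ⟨Q, hQ, hcard.trans (Finset.card_image_le.trans ?_)⟩
  rw [Set.ncard_eq_toFinset_card']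

lemma IsMinPathCover.isMinZeroForcingSet_headSet [Fintype V] {T : SimpleGraph V} (hT : T.IsTree)
    {P : Finset (List V)} (hP : IsMinPathCover T P) : IsMinZeroForcingSet T (headSet P) := by
  refine ⟨hP.1.isZeroForcingSet_headSet hT, fun S hS => ?_⟩
  obtain ⟨Q, hQ, hcard⟩ := hS.exists_isPathCover
  exact (headSet_ncard_le P).trans ((hP.2 Q hQ).trans hcard)

lemma IsMinPathCover.reverse_path {P : Finset (List V)} (hP : IsMinPathCover G P) {l : List V}
    (hl : l ∈ P) : IsMinPathCover G (insert l.reverse (P.erase l)) := by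
  obtain ⟨⟨hpath, hcov, hdisj⟩, hmin⟩ := hP
  refine ⟨⟨?_, ?_, ?_⟩, fun Q hQ => ?_⟩
  · intro l' hl'
    rcases Finset.mem_insert.1 hl' with rfl | hl'
    · exact (hpath l hl).reverse
    · exact hpath _ (Finset.mem_of_mem_erase hl')
  · intro v
    obtain ⟨l', hl', hv⟩ := hcov v
    by_cases h : l' = l
    · exact ⟨_, Finset.mem_insert_self _ _, by simpa [← h] using hv⟩
    · exact ⟨l', by simp [h, hl'], hv⟩
  · intro l₁ h₁ l₂ h₂ hne w hw₁ hw₂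
    rcases Finset.mem_insert.1 h₁ with rfl | h₁ <;> rcases Finset.mem_insert.1 h₂ with rfl | h₂
    · exact hne rfl
    · obtain ⟨hn, h₂⟩ := Finset.mem_erase.1 h₂
      exact hdisj _ hl _ h₂ hn.symm w (by simpa using hw₁) hw₂
    · obtain ⟨hn, h₁⟩ := Finset.mem_erase.1 h₁
      exact hdisj _ h₁ _ hl hn w hw₁ (by simpa using hw₂)
    · exact hdisj _ (Finset.mem_of_mem_erase h₁) _ (Finset.mem_of_mem_erase h₂) hne w hw₁ hw₂
  · refine ((Finset.card_insert_le _ _).trans ?_).trans (hmin Q hQ)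
    rw [Finset.card_erase_add_one hl]

/-- The ends of a path of a minimum path cover of an iso-unique zero forcing tree lie in the same
orbit of the automorphism group. -/
lemma IsMinPathCover.exists_iso_head_eq_getLast [Fintype V] {T : SimpleGraph V} (hT : T.IsTree)
    (hiso : IsoUniqueZF T) {P : Finset (List V)} (hP : IsMinPathCover T P) {l : List V}
    (hl : l ∈ P) (h : l ≠ []) : ∃ φ : T ≃g T, φ (l.head h) = l.getLast h := by
  obtain ⟨φ, hφ⟩ := hiso _ _ (hP.isMinZeroForcingSet_headSet hT)
    ((hP.reverse_path hl).isMinZeroForcingSet_headSet hT)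
  have hins (l' : List V) (h' : l' ≠ []) :
      headSet (insert l' (P.erase l)) = insert (l'.head h') (headSet (P.erase l)) := by
    ext v
    simp [headSet, List.head?_eq_some_head h', eq_comm]
  have e1 := hins l h
  rw [Finset.insert_erase hl] at e1
  rw [e1, hins l.reverse (by simpa)] at hφ
  have hnot : l.head h ∉ headSet (P.erase l) := by
    rintro ⟨l', hl', hhead⟩
    obtain ⟨hne, hl'⟩ := Finset.mem_erase.1 hl'
    exact hP.1.2.2 l hl l' hl' hne.symm _ (List.head_mem h) (List.mem_of_head? hhead)
  obtain ⟨ψ, hψ⟩ := exists_iso_apply_eq_of_image_insert hnot φ hφ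
  exact ⟨ψ, by rw [hψ, List.head_reverse]⟩

end PathCover

section Symmetry

variable {V W : Type*}

/-- An automorphism of a tree mapping one end of a path to the other maps the first half of the
path, including the middle vertex or edge, to the reverse of the second half. -/
lemma SimpleGraph.IsTree.iso_apply_eq_reflection [Finite V] {T : SimpleGraph V} (hT : T.IsTree)
    (φ : T ≃g T) {x : ℕ → V} {k : ℕ} (hadj : ∀ i < k, T.Adj (x i) (x (i + 1)))
    (hne : ∀ i, i + 2 ≤ k → x i ≠ x (i + 2)) (hφ : φ (x 0) = x k) :
    ∀ i, 2 * i ≤ k + 1 → φ (x i) = x (k - i) := by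
  have hfirst : ∀ i ≤ k, T.dist (x i) (x 0) = i := by
    obtain ⟨q, hq, h⟩ := hT.exists_dist_eq_along_path hadj hne (x 0)
    intro i hi
    have h0 := h 0 (by omega)
    have hi := h i hi
    rw [SimpleGraph.dist_self] at h0
    rw [SimpleGraph.dist_comm]
    omega
  have hlast : ∀ i ≤ k, T.dist (x i) (x k) = k - i := by
    obtain ⟨q, hq, h⟩ := hT.exists_dist_eq_along_path hadj hne (x k)
    intro i hi
    have hk := h k le_rfl
    have hi := h i hi
    rw [SimpleGraph.dist_self] at hk
    rw [SimpleGraph.dist_comm]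
    omega
  have hflip : ∀ c c', T.Adj c c' → φ c = c' → φ c' = c → T.dist c' (x 0) = T.dist c (x 0) + 1 →
      ∀ i, 2 * i ≤ k + 1 → φ (x i) = x (k - i) := by
    intro c c' hcc hc hc' hd i hi
    obtain ⟨q, hq, h⟩ := hT.exists_dist_eq_along_path hadj hne c
    obtain ⟨q', hq', h'⟩ := hT.exists_dist_eq_along_path hadj hne c'
    have e1 := φ.dist_eq c (x 0)
    have e2 := φ.dist_eq c' (x 0)
    rw [hc, hφ] at e1
    rw [hc', hφ] at e2
    have h0 := h 0 (by omega)
    have hk := h k le_rfl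
    have h0' := h' 0 (by omega)
    have hk' := h' k le_rfl
    obtain rfl : k = 2 * q + 1 := by omega
    obtain rfl : q' = q + 1 := by omega
    by_cases hiq : i ≤ q
    · have e3 := φ.dist_eq c (x i)
      have e4 := φ.dist_eq (x i) (x 0)
      rw [hc] at e3
      rw [hφ] at e4
      have := h i (by omega)
      have := h' (2 * q + 1 - i) (by omega)
      have := hfirst i (by omega)
      have := hlast (2 * q + 1 - i) (by omega)
      exact hT.eq_of_dist_add_dist (c := c') (y := x (2 * q + 1))
        (by omega) (by omega) (by omega)
    · obtain rfl : i = q + 1 := by omega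
      have h1 := h (q + 1) (by omega)
      have h1' := h' q (by omega)
      obtain ⟨hxc, hxc'⟩ := hT.eq_of_adj_of_adj_of_dist_lt hcc (hadj q (by omega))
        (by omega) (by omega)
      rw [show 2 * q + 1 - (q + 1) = q by omega, hxc, hxc', hc']
  obtain ⟨c, hc | ⟨hadjc, hc⟩⟩ := hT.exists_fixed_vertex_or_edge φ
  · intro i hi
    obtain ⟨q, hq, h⟩ := hT.exists_dist_eq_along_path hadj hne c
    have e1 := φ.dist_eq c (x 0)
    have e2 := φ.dist_eq c (x i)
    have e3 := φ.dist_eq (x i) (x 0)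
    rw [hc, hφ] at e1
    rw [hc] at e2
    rw [hφ] at e3
    have h0 := h 0 (by omega)
    have hk := h k le_rfl
    obtain rfl : k = 2 * q := by omega
    have := h i (by omega)
    have := h (2 * q - i) (by omega)
    have := hfirst i (by omega)
    have := hlast (2 * q - i) (by omega)
    exact hT.eq_of_dist_add_dist (c := c) (y := x (2 * q)) (by omega) (by omega) (by omega)
  · have hstep := hT.dist_eq_dist_add_one_of_adj (x 0) hadjc
    simp only [SimpleGraph.dist_comm (u := x 0)] at hstep
    rcases hstep with h | h
    · exact hflip _ _ hadjc.symm hc rfl h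
    · exact hflip _ _ hadjc rfl hc h

/-- If `φ` moves `B` off itself and every edge leaving `B` ends in a fixed vertex of `φ` or is
flipped by `φ`, then some automorphism exchanges `B` and `φ '' B` by means of `φ` and its
inverse. -/
lemma SimpleGraph.Iso.exists_swap {G : SimpleGraph V} (φ : G ≃g G) (B : Set V)
    (hB : ∀ v ∈ B, φ v ∉ B)
    (hbd : ∀ v ∈ B, ∀ w ∉ B, G.Adj v w → φ w = w ∨ φ v = w ∧ φ w = v) :
    ∃ ψ : G ≃g G, ∀ v ∈ B, ψ v = φ v ∧ ψ (φ v) = v := by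
  classical
  let f : V → V := fun v => if v ∈ B then φ v else if φ.symm v ∈ B then φ.symm v else v
  have f1 {v} (h : v ∈ B) : f v = φ v := if_pos h
  have f2 {v} (h : v ∈ B) : f (φ v) = v := by simp [f, hB v h, h]
  have f3 {v} (h : v ∉ B) (h' : φ.symm v ∉ B) : f v = v := by simp [f, h, h']
  have hcases (v : V) : v ∈ B ∨ (∃ u ∈ B, v = φ u) ∨ (v ∉ B ∧ φ.symm v ∉ B) := by
    by_cases h : v ∈ B
    · exact Or.inl h
    · by_cases h' : φ.symm v ∈ B
      · exact Or.inr (Or.inl ⟨_, h', by simp⟩)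
      · exact Or.inr (Or.inr ⟨h, h'⟩)
  have hinv : Function.Involutive f := by
    intro v
    rcases hcases v with h | ⟨u, h, rfl⟩ | ⟨h, h'⟩
    · rw [f1 h, f2 h]
    · rw [f2 h, f1 h]
    · rw [f3 h h', f3 h h']
  have hleft {v w} (hv : v ∈ B) (hw : w ∉ B) (hvw : G.Adj v w) : G.Adj (f v) (f w) := by
    rcases hbd v hv w hw hvw with h | ⟨rfl, -⟩
    · have h' : φ.symm w = w := by rw [RelIso.symm_apply_eq, h]
      rw [f1 hv, f3 hw (by rwa [h']), ← h]
      exact φ.map_adj_iff.2 hvw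
    · rw [f1 hv, f2 hv]
      exact hvw.symm
  have hright {u w} (hu : u ∈ B) (hw : w ∉ B) (hw' : φ.symm w ∉ B) (h : G.Adj (φ u) w) :
      G.Adj (f (φ u)) (f w) := by
    have hadj : G.Adj u (φ.symm w) := by
      rw [← φ.map_adj_iff, φ.apply_symm_apply]
      exact h
    rw [f2 hu, f3 hw hw']
    rcases hbd u hu _ hw' hadj with e | ⟨-, e⟩
    · rw [φ.apply_symm_apply] at e
      rwa [← e] at hadj
    · rw [φ.apply_symm_apply] at e
      exact absurd (e ▸ hu) hw
  have hadj : ∀ v w, G.Adj v w → G.Adj (f v) (f w) := by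
    intro v w h
    by_cases hv : v ∈ B <;> by_cases hw : w ∈ B
    · rw [f1 hv, f1 hw]
      exact φ.map_adj_iff.2 h
    · exact hleft hv hw h
    · exact (hleft hw hv h.symm).symm
    · rcases hcases v with h1 | ⟨u, h1, rfl⟩ | ⟨-, h1⟩
      · exact absurd h1 hv
      · rcases hcases w with h2 | ⟨u', h2, rfl⟩ | ⟨-, h2⟩
        · exact absurd h2 hw
        · rw [f2 h1, f2 h2]
          exact φ.map_adj_iff.1 h
        · exact hright h1 hw h2 h
      · rcases hcases w with h2 | ⟨u', h2, rfl⟩ | ⟨-, h2⟩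
        · exact absurd h2 hw
        · exact (hright h2 hv h1 h.symm).symm
        · rwa [f3 hv h1, f3 hw h2]
  refine ⟨⟨hinv.toPerm f, fun {v w} => ⟨fun h => ?_, hadj v w⟩⟩, fun v hv => ⟨f1 hv, f2 hv⟩⟩
  simpa only [Function.Involutive.coe_toPerm, hinv v, hinv w] using hadj _ _ h

/-- An isomorphism restricts to an isomorphism of induced subgraphs. -/
def SimpleGraph.Iso.induceOfMemIff {G : SimpleGraph V} {H : SimpleGraph W} (φ : G ≃g H)
    (s : Set V) (t : Set W) (h : ∀ v, v ∈ s ↔ φ v ∈ t) : G.induce s ≃g H.induce t where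
  toEquiv := φ.toEquiv.subtypeEquiv h
  map_rel_iff' := φ.map_adj_iff

lemma nonempty_componentGraphOf_iso {G : SimpleGraph V} {H : SimpleGraph W} (φ : G ≃g H) (u : V) :
    Nonempty (componentGraphOf G u ≃g componentGraphOf H (φ u)) :=
  ⟨φ.induceOfMemIff _ _ fun _ => φ.reachable_iff.symm⟩

/-- An automorphism flipping the edge `ab` restricts to the graph without that edge. -/
def SimpleGraph.Iso.deleteEdgeOfFlip {G : SimpleGraph V} (φ : G ≃g G) {a b : V} (ha : φ a = b)
    (hb : φ b = a) : G.deleteEdges {s(a, b)} ≃g G.deleteEdges {s(a, b)} where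
  toEquiv := φ.toEquiv
  map_rel_iff' {u v} := by
    have h : s(φ u, φ v) = s(a, b) ↔ s(u, v) = s(a, b) := by
      rw [← (Sym2.map.injective φ.injective).eq_iff (a := s(u, v)), Sym2.map_mk, Sym2.map_mk,
        ha, hb, Sym2.eq_swap (a := b)]
    have hadj : G.Adj (φ u) (φ v) ↔ G.Adj u v := φ.map_adj_iff
    change (G.deleteEdges {s(a, b)}).Adj (φ u) (φ v) ↔ _
    rw [SimpleGraph.deleteEdges_adj, SimpleGraph.deleteEdges_adj, Set.mem_singleton_iff,
      Set.mem_singleton_iff, h, hadj]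

/-- If an automorphism of a finite tree maps one end of a path to the other, then some
automorphism exchanges the two ends. -/
lemma SimpleGraph.IsTree.exists_iso_swap_ends [Finite V] {T : SimpleGraph V} (hT : T.IsTree)
    (φ : T ≃g T) {x : ℕ → V} {k : ℕ} (hadj : ∀ i < k, T.Adj (x i) (x (i + 1)))
    (hne : ∀ i, i + 2 ≤ k → x i ≠ x (i + 2)) (hφ : φ (x 0) = x k) :
    ∃ ψ : T ≃g T, ψ (x 0) = x k ∧ ψ (x k) = x 0 := by
  have hrefl := hT.iso_apply_eq_reflection φ hadj hne hφ
  rcases Nat.eq_zero_or_pos k with rfl | hk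
  · exact ⟨SimpleGraph.Iso.refl, rfl, rfl⟩
  obtain ⟨j, hj⟩ : ∃ j, k = 2 * j + 1 ∨ k = 2 * j + 2 := ⟨(k - 1) / 2, by omega⟩
  have hjadj := hadj j (by omega)
  let B : Set V := {v | T.dist (x j) v < T.dist (x (j + 1)) v}
  have h0 : x 0 ∈ B := by
    obtain ⟨q, hq, h⟩ := hT.exists_dist_eq_along_path hadj hne (x 0)
    have e0 := h 0 (by omega)
    have e1 := h j (by omega)
    have e2 := h (j + 1) (by omega)
    rw [SimpleGraph.dist_self] at e0
    change T.dist (x j) (x 0) < T.dist (x (j + 1)) (x 0)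
    rw [SimpleGraph.dist_comm, SimpleGraph.dist_comm (u := x (j + 1))]
    omega
  have hmid : (φ (x j) = x (j + 1) ∧ φ (x (j + 1)) = x j) ∨
      (φ (x j) = x (j + 2) ∧ φ (x (j + 1)) = x (j + 1) ∧ j + 2 ≤ k) := by
    have e1 := hrefl j (by omega)
    have e2 := hrefl (j + 1) (by omega)
    rcases hj with hj | hj
    · left
      rw [e1, e2, show k - j = j + 1 by omega, show k - (j + 1) = j by omega]
      exact ⟨rfl, rfl⟩
    · right
      rw [e1, e2, show k - j = j + 2 by omega, show k - (j + 1) = j + 1 by omega]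
      exact ⟨rfl, rfl, by omega⟩
  suffices h : ∃ ψ : T ≃g T, ∀ v ∈ B, ψ v = φ v ∧ ψ (φ v) = v by
    obtain ⟨ψ, hψ⟩ := h
    exact ⟨ψ, hφ ▸ hψ _ h0⟩
  apply φ.exists_swap B
  · intro v (hv : T.dist _ _ < T.dist _ _) (hv' : T.dist _ _ < T.dist _ _)
    rw [← φ.dist_eq, ← φ.dist_eq (x (j + 1))] at hv
    rcases hmid with ⟨e1, e2⟩ | ⟨e1, e2, hk'⟩
    · rw [e1, e2] at hv
      omega
    · rw [e1, e2] at hv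
      simp only [SimpleGraph.dist_comm (v := φ v)] at hv hv'
      exact hne j hk' (hT.eq_of_adj_of_dist_lt hjadj.symm (hadj (j + 1) (by omega)) hv' hv)
  · intro v (hv : T.dist _ _ < T.dist _ _) w (hw : ¬ T.dist _ _ < T.dist _ _) hvw
    have hw' := hT.dist_ne_of_adj w hjadj
    simp only [SimpleGraph.dist_comm (u := w)] at hw'
    obtain ⟨rfl, rfl⟩ := hT.eq_of_adj_of_adj_of_dist_lt hjadj hvw hv (by omega)
    rcases hmid with h | h
    · exact Or.inr h
    · exact Or.inl h.2.1

end Symmetry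

/-- Let `T` be a finite tree which is an iso-unique zero forcing graph, let `P` be a
minimum path cover of `T` and let `l = x₁,…,x_ℓ` be a path of `P` (indexed from 0 below,
so the 1-based middle position `p = (ℓ+1)/2` for odd `ℓ` corresponds to the 0-based index
`i` with `2*i + 1 = ℓ`, and the 1-based positions `p, p+1` with `p = ℓ/2` for even `ℓ`
correspond to 0-based indices `i, j = i+1` with `2*j = ℓ`).
(a) For odd `ℓ`, the components of `T - x_p` containing `x_{p-1}` and `x_{p+1}` are
isomorphic; (b) for even `ℓ`, the components of `T` with the edge `x_p x_{p+1}` deleted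
containing `x_p` and `x_{p+1}` are isomorphic. Moreover, some automorphism of `T`
exchanges `x₁` and `x_ℓ`. -/
theorem middle_components_isomorphic {V : Type*} [Fintype V] [DecidableEq V]
    (T : SimpleGraph V) (hT : T.IsTree) (hiso : IsoUniqueZF T)
    (P : Finset (List V)) (hP : IsMinPathCover T P)
    (l : List V) (hl : l ∈ P) :
    ((∀ i j k : Fin l.length, 2 * (i : ℕ) + 1 = l.length →
        (j : ℕ) + 1 = (i : ℕ) → (i : ℕ) + 1 = (k : ℕ) →
        ∀ (hj : l.get j ∈ ({v : V | v ≠ l.get i} : Set V))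
          (hk : l.get k ∈ ({v : V | v ≠ l.get i} : Set V)),
        Nonempty
          (componentGraphOf (T.induce {v : V | v ≠ l.get i}) ⟨l.get j, hj⟩ ≃g
           componentGraphOf (T.induce {v : V | v ≠ l.get i}) ⟨l.get k, hk⟩)) ∧
     (∀ i j : Fin l.length, (j : ℕ) = (i : ℕ) + 1 → 2 * (j : ℕ) = l.length →
        Nonempty
          (componentGraphOf (T.deleteEdges {s(l.get i, l.get j)}) (l.get i) ≃g
           componentGraphOf (T.deleteEdges {s(l.get i, l.get j)}) (l.get j)))) ∧
    (∀ h : l ≠ [], ∃ φ : T ≃g T, φ (l.head h) = l.getLast h ∧ φ (l.getLast h) = l.head h) := by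
  have hpath := hP.1.1 l hl
  have hnil : l ≠ [] := hpath.1
  obtain ⟨φ, hφ⟩ := hP.exists_iso_head_eq_getLast hT hiso hl hnil
  obtain ⟨x, hx, hadj, -, hne⟩ := hpath.exists_parametrization
  have hlen : 0 < l.length := List.length_pos_iff.2 hnil
  have hhead : l.head hnil = x 0 := by
    rw [List.head_eq_getElem]
    exact hx 0 hlen
  have hlast : l.getLast hnil = x (l.length - 1) := by
    rw [List.getLast_eq_getElem]
    exact hx _ (by omega)
  rw [hhead, hlast] at hφ
  have hadj' : ∀ i < l.length - 1, T.Adj (x i) (x (i + 1)) := fun i hi => hadj i (by omega)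
  have hne' : ∀ i, i + 2 ≤ l.length - 1 → x i ≠ x (i + 2) :=
    fun i hi => hne i (i + 2) (by omega) (by omega)
  have hrefl := hT.iso_apply_eq_reflection φ hadj' hne' hφ
  have hget (i j : Fin l.length) (hi : 2 * (i : ℕ) ≤ l.length) (hij : (i : ℕ) + j + 1 = l.length) :
      φ (l.get i) = l.get j := by
    rw [hx i i.2, hx j j.2, hrefl i (by omega), show l.length - 1 - (i : ℕ) = j by omega]
  refine ⟨⟨fun i j k hi hj hk hjm hkm => ?_, fun i j hij hj => ?_⟩, fun h => ?_⟩
  · have hfix := hget i i (by omega) (by omega)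
    have hmem (v : V) : v ∈ {v : V | v ≠ l.get i} ↔ φ v ∈ {v : V | v ≠ l.get i} := by
      change v ≠ l.get i ↔ φ v ≠ l.get i
      rw [← φ.injective.ne_iff, hfix]
    have hjk : φ.induceOfMemIff _ _ hmem ⟨l.get j, hjm⟩ = ⟨l.get k, hkm⟩ :=
      Subtype.ext (hget j k (by omega) (by omega))
    rw [← hjk]
    exact nonempty_componentGraphOf_iso _ _
  · have hi' := hget i j (by omega) (by omega)
    have hj' := hget j i (by omega) (by omega)
    have := nonempty_componentGraphOf_iso (φ.deleteEdgeOfFlip hi' hj') (l.get i)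
    rwa [show φ.deleteEdgeOfFlip hi' hj' (l.get i) = l.get j from hi'] at this
  · rw [hhead, hlast]
    exact hT.exists_iso_swap_ends φ hadj' hne' hφ
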